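/- There exists an absolute constant C > 0 such that for all families (g_J)_{J∈D} and (u_I)_{I∈D} of L²(ℝ) functions with only finitely many nonzero members, the square function of the sequence A_{IJ} := ⟨g_J⟩_I ⟨u_I⟩_J satisfies ‖s_A‖_{L¹(ℝ²)} ≤ C (Σ_J ‖g_J‖₂²)^{1/2} (Σ_I ‖u_I‖₂²)^{1/2}, where s_A := (Σ_{I,J} |A_{IJ}|² 1_{I×J}/(|I||J|))^{1/2}. -/

import Mathlib

open MeasureTheory
open scoped ENNReal

noncomputable section

/-- A sequence `λ = (λ_{IJ})` indexed by pairs of dyadic intervals; a dyadic interval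
`[2^{-i}k, 2^{-i}(k+1))` is encoded by the pair `(i, k) : ℤ × ℤ`. -/
abbrev ParaSeq := (ℤ × ℤ) → (ℤ × ℤ) → ℝ

/-- The dyadic interval `[2^{-i} k, 2^{-i}(k+1))` encoded by the pair `p = (i, k) : ℤ × ℤ`. -/
def dyadic (p : ℤ × ℤ) : Set ℝ := Set.Ico ((2:ℝ) ^ (-p.1) * p.2) ((2:ℝ) ^ (-p.1) * (p.2 + 1))

/-- The length `|I| = 2^{-i}` of the dyadic interval encoded by `p = (i, k)`. -/
def dlen (p : ℤ × ℤ) : ℝ := (2:ℝ) ^ (-p.1)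

/-- The average `⟨f⟩_I = |I|⁻¹ ∫_I f`. -/
def avg (f : ℝ → ℝ) (p : ℤ × ℤ) : ℝ := (dlen p)⁻¹ * ∫ x in dyadic p, f x

/-- Admissible families `(u_I)_{I ∈ D}` of `L²(ℝ)` functions: only finitely many nonzero
members and `Σ_I ‖u_I‖₂² = 1`. -/
def Adm : Set ((ℤ × ℤ) → ℝ → ℝ) :=
  {u | (∀ p, MemLp (u p) 2 volume) ∧ {p | u p ≠ 0}.Finite ∧ (∑' p : ℤ × ℤ, ∫ x, (u p x) ^ 2) = 1}

/-- The bilinear sum `Σ_{I,J} λ_{IJ} ⟨g_J⟩_I ⟨u_I⟩_J`. -/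
def pairSum (lam : ParaSeq) (u g : (ℤ × ℤ) → ℝ → ℝ) : ℝ :=
  ∑' pq : (ℤ × ℤ) × (ℤ × ℤ), lam pq.1 pq.2 * avg (g pq.2) pq.1 * avg (u pq.1) pq.2

/-- The norm `‖λ‖_X`, as an element of `[0, ∞]`. -/
def Xnorm (lam : ParaSeq) : ℝ≥0∞ :=
  ⨆ (u : Adm) (g : Adm), ENNReal.ofReal |pairSum lam u.1 g.1|

/-- The norm `‖λ‖_{X'}`, as an element of `[0, ∞]`. -/
def Xprime (lam : ParaSeq) : ℝ≥0∞ :=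
  ⨆ (u : Adm) (g : Adm),
    ENNReal.ofReal
      (∑' pq : (ℤ × ℤ) × (ℤ × ℤ), |lam pq.1 pq.2 * avg (g.1 pq.2) pq.1 * avg (u.1 pq.1) pq.2|)

/-- The square function `s_A = (Σ_{I,J} |A_{IJ}|² 1_{I×J} / (|I||J|))^{1/2}`. -/
def sqfn (A : ParaSeq) (z : ℝ × ℝ) : ℝ :=
  Real.sqrt (∑' pq : (ℤ × ℤ) × (ℤ × ℤ),
    (A pq.1 pq.2) ^ 2 * Set.indicator (dyadic pq.1 ×ˢ dyadic pq.2) 1 z / (dlen pq.1 * dlen pq.2))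

open scoped NNReal

lemma dlen_pos (p : ℤ × ℤ) : 0 < dlen p := by unfold dlen; positivity

lemma measurableSet_dyadic (p : ℤ × ℤ) : MeasurableSet (dyadic p) := measurableSet_Ico

lemma volume_dyadic (p : ℤ × ℤ) : volume (dyadic p) = ENNReal.ofReal (dlen p) := by
  rw [dyadic, dlen, Real.volume_Ico]
  congr 1
  ring

/-- A dyadic interval that is at least as short as another one is contained in it or disjoint
from it. -/
lemma dyadic_subset_or_disjoint {p q : ℤ × ℤ} (h : q.1 ≤ p.1) :
    dyadic p ⊆ dyadic q ∨ Disjoint (dyadic p) (dyadic q) := by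
  obtain ⟨i, k⟩ := p
  obtain ⟨j, l⟩ := q
  obtain ⟨n, hn⟩ := Int.eq_ofNat_of_zero_le (sub_nonneg.2 h)
  simp only [] at hn h
  have hi : (2 : ℝ) ^ (-j) = 2 ^ (-i) * ((2 ^ n : ℤ) : ℝ) := by
    rw [show -j = -i + (n : ℤ) by omega, zpow_add₀ two_ne_zero, zpow_natCast]
    push_cast
    rfl
  have hpos : (0 : ℝ) < 2 ^ (-i) := by positivity
  simp only [dyadic, hi, mul_assoc]
  have key (a b : ℤ) (hab : a ≤ b) : (2 : ℝ) ^ (-i) * a ≤ 2 ^ (-i) * b := by gcongr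
  rcases lt_or_ge k (2 ^ n * l) with h1 | h1
  · right
    have := key _ _ (Int.add_one_le_iff.2 h1)
    push_cast at this ⊢
    exact Set.disjoint_left.2 fun x hx hx' => by linarith [hx.2, hx'.1]
  rcases lt_or_ge k (2 ^ n * (l + 1)) with h2 | h2
  · left
    have h3 := key _ _ h1
    have h4 := key _ _ (Int.add_one_le_iff.2 h2)
    push_cast at h3 h4 ⊢
    exact Set.Ico_subset_Ico h3 h4
  · right
    have := key _ _ h2
    push_cast at this ⊢
    exact Set.disjoint_left.2 fun x hx hx' => by linarith [hx.1, hx'.2]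

lemma mul_volume_biUnion_dyadic_le {h : ℝ → ℝ≥0∞} {t : ℝ≥0∞} (F : Finset (ℤ × ℤ))
    (hF : ∀ p ∈ F, t * volume (dyadic p) ≤ ∫⁻ x in dyadic p, h x) :
    t * volume (⋃ p ∈ F, dyadic p) ≤ ∫⁻ x in ⋃ p ∈ F, dyadic p, h x := by
  induction F using Finset.induction_on_max_value (fun p : ℤ × ℤ => p.1) with
  | empty => simp
  | insert a s ha hmax ih =>
    have ih' := ih fun p hp => hF p (Finset.mem_insert_of_mem hp)
    have hU : (⋃ p ∈ insert a s, dyadic p) = dyadic a ∪ ⋃ p ∈ s, dyadic p :=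
      Finset.set_biUnion_insert a s dyadic
    by_cases hsub : ∃ q ∈ s, dyadic a ⊆ dyadic q
    · obtain ⟨q, hq, hsub⟩ := hsub
      rwa [hU, Set.union_eq_right.2
        (hsub.trans (Set.subset_iUnion₂ (s := fun p (_ : p ∈ s) => dyadic p) q hq))]
    · push Not at hsub
      have hd : Disjoint (dyadic a) (⋃ p ∈ s, dyadic p) :=
        Set.disjoint_iUnion₂_right.2 fun q hq =>
          (dyadic_subset_or_disjoint (hmax q hq)).resolve_left (hsub q hq)
      have hm : MeasurableSet (⋃ p ∈ s, dyadic p) :=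
        s.measurableSet_biUnion fun p _ => measurableSet_dyadic p
      rw [hU, measure_union hd hm, lintegral_union hm hd, mul_add]
      exact add_le_add (hF a (Finset.mem_insert_self a s)) ih'

/-- The maximal function `x ↦ max {a p | p ∈ F, x ∈ dyadic p}`. -/
def dyadicSup (F : Finset (ℤ × ℤ)) (a : ℤ × ℤ → ℝ≥0) (x : ℝ) : ℝ≥0 :=
  F.sup fun p => (dyadic p).indicator (fun _ => a p) x

lemma measurable_dyadicSup (F : Finset (ℤ × ℤ)) (a : ℤ × ℤ → ℝ≥0) :
    Measurable (dyadicSup F a) := by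
  have : dyadicSup F a = F.sup fun p => (dyadic p).indicator (fun _ => a p) := by
    ext x; simp [dyadicSup, Finset.sup_apply]
  rw [this]
  exact Finset.sup_induction measurable_const (fun _ hf _ hg => hf.sup hg) fun p _ =>
    measurable_const.indicator (measurableSet_dyadic p)

lemma le_dyadicSup {F : Finset (ℤ × ℤ)} (a : ℤ × ℤ → ℝ≥0) {p : ℤ × ℤ} (hp : p ∈ F) {x : ℝ}
    (hx : x ∈ dyadic p) : a p ≤ dyadicSup F a x := by
  have := Finset.le_sup (f := fun p => (dyadic p).indicator (fun _ => a p) x) hp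
  simp only [hx, Set.indicator_of_mem] at this
  exact this

lemma setOf_lt_dyadicSup (F : Finset (ℤ × ℤ)) (a : ℤ × ℤ → ℝ≥0) (t : ℝ≥0) :
    {x | t < dyadicSup F a x} = ⋃ p ∈ F.filter (fun p => t < a p), dyadic p := by
  ext x
  simp only [Set.mem_ofPred_eq, dyadicSup, Finset.lt_sup_iff, Set.mem_iUnion, Finset.mem_filter,
    exists_prop]
  constructor
  · rintro ⟨p, hp, h⟩
    by_cases hx : x ∈ dyadic p
    · exact ⟨p, ⟨hp, by simpa [hx] using h⟩, hx⟩
    · simp [hx] at h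
  · rintro ⟨p, ⟨hp, h⟩, hx⟩
    exact ⟨p, hp, by simpa [hx] using h⟩

lemma lintegral_dyadicSup_sq_ne_top (F : Finset (ℤ × ℤ)) (a : ℤ × ℤ → ℝ≥0) :
    ∫⁻ x, (dyadicSup F a x : ℝ≥0∞) ^ 2 ≠ ∞ := by
  have hle (x : ℝ) : (dyadicSup F a x : ℝ≥0∞) ^ 2 ≤
      ∑ p ∈ F, (dyadic p).indicator (fun _ => (a p : ℝ≥0∞) ^ 2) x := by
    rcases F.eq_empty_or_nonempty with rfl | hF
    · simp [dyadicSup]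
    · obtain ⟨p, hp, h⟩ := F.exists_mem_eq_sup hF fun p => (dyadic p).indicator (fun _ => a p) x
      refine le_trans ?_ (Finset.single_le_sum (fun _ _ => zero_le) hp)
      rw [dyadicSup, h]
      by_cases hx : x ∈ dyadic p <;> simp [hx]
  refine ((lintegral_mono hle).trans_lt ?_).ne
  rw [lintegral_finsetSum _ fun p _ => measurable_const.indicator (measurableSet_dyadic p)]
  refine ENNReal.sum_lt_top.2 fun p _ => ?_
  rw [lintegral_indicator_const (measurableSet_dyadic p), volume_dyadic]
  finiteness

/-- The `L²` bound for the dyadic maximal function. -/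
lemma lintegral_dyadicSup_sq_le {h : ℝ → ℝ≥0∞} (hm : AEMeasurable h) (F : Finset (ℤ × ℤ))
    (a : ℤ × ℤ → ℝ≥0) (ha : ∀ p, a p * volume (dyadic p) ≤ ∫⁻ x in dyadic p, h x) :
    ∫⁻ x, (dyadicSup F a x : ℝ≥0∞) ^ 2 ≤ 4 * ∫⁻ x, h x ^ 2 := by
  set M : ℝ → ℝ := fun x => dyadicSup F a x with hM
  have hMm : Measurable M := (measurable_dyadicSup F a).coe_nnreal_real
  have hofReal (x : ℝ) : ENNReal.ofReal (M x) = dyadicSup F a x := ENNReal.ofReal_coe_nnreal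
  have hweak (t : ℝ) (ht : 0 < t) :
      volume {x | t < M x} * ENNReal.ofReal (t ^ ((2 : ℝ) - 1)) ≤
        (volume.withDensity h) {x | t < M x} := by
    lift t to ℝ≥0 using ht.le
    have hset : {x | (t : ℝ) < M x} = ⋃ p ∈ F.filter (fun p => t < a p), dyadic p := by
      rw [← setOf_lt_dyadicSup]
      simp [hM]
    rw [withDensity_apply _ (measurableSet_lt measurable_const hMm), hset, mul_comm]
    norm_num
    have := mul_volume_biUnion_dyadic_le (t := (t : ℝ≥0∞)) (h := h)
      (F.filter (fun p => t < a p)) fun p hp => le_trans (by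
        gcongr; exact (Finset.mem_filter.1 hp).2.le) (ha p)
    simpa using this
  have h1 : ∫⁻ x, (dyadicSup F a x : ℝ≥0∞) ^ 2 ≤ 2 * ∫⁻ x, h x * dyadicSup F a x := by
    calc ∫⁻ x, (dyadicSup F a x : ℝ≥0∞) ^ 2 = ∫⁻ x, ENNReal.ofReal (M x ^ (2 : ℝ)) := by
          congr with x
          rw [Real.rpow_two, ENNReal.ofReal_pow (NNReal.coe_nonneg _), hofReal]
      _ = ENNReal.ofReal 2 * ∫⁻ t in Set.Ioi 0, volume {x | t < M x} *
            ENNReal.ofReal (t ^ ((2 : ℝ) - 1)) :=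
          lintegral_rpow_eq_lintegral_meas_lt_mul _ (ae_of_all _ fun x => NNReal.coe_nonneg _)
            hMm.aemeasurable two_pos
      _ ≤ ENNReal.ofReal 2 * ∫⁻ t in Set.Ioi 0, (volume.withDensity h) {x | t < M x} := by
          gcongr ENNReal.ofReal 2 * ?_
          exact setLIntegral_mono' measurableSet_Ioi hweak
      _ = 2 * ∫⁻ x, ENNReal.ofReal (M x) ∂(volume.withDensity h) := by
          rw [lintegral_eq_lintegral_meas_lt _ (ae_of_all _ fun x => NNReal.coe_nonneg _)
            hMm.aemeasurable, ENNReal.ofReal_ofNat]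
      _ = 2 * ∫⁻ x, h x * dyadicSup F a x := by
          rw [lintegral_withDensity_eq_lintegral_mul₀ hm hMm.ennreal_ofReal.aemeasurable]
          simp [hofReal]
  have hyoung (m : ℝ≥0) (b : ℝ≥0∞) : 4 * (b * m) ≤ (m : ℝ≥0∞) ^ 2 + 4 * b ^ 2 := by
    induction b with
    | top => simp
    | coe b =>
      norm_cast
      rw [← NNReal.coe_le_coe]
      push_cast
      nlinarith [sq_nonneg ((m : ℝ) - 2 * b)]
  have hMe : Measurable fun x => (dyadicSup F a x : ℝ≥0∞) ^ 2 :=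
    (measurable_dyadicSup F a).coe_nnreal_ennreal.pow_const 2
  have h2 : 2 * ∫⁻ x, (dyadicSup F a x : ℝ≥0∞) ^ 2 ≤
      (∫⁻ x, (dyadicSup F a x : ℝ≥0∞) ^ 2) + 4 * ∫⁻ x, h x ^ 2 := by
    calc 2 * ∫⁻ x, (dyadicSup F a x : ℝ≥0∞) ^ 2
        ≤ 2 * (2 * ∫⁻ x, h x * dyadicSup F a x) := by gcongr
      _ = ∫⁻ x, 4 * (h x * dyadicSup F a x) := by
          rw [lintegral_const_mul' _ _ (by simp), ← mul_assoc]
          norm_num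
      _ ≤ ∫⁻ x, ((dyadicSup F a x : ℝ≥0∞) ^ 2 + 4 * h x ^ 2) := lintegral_mono fun x => hyoung _ _
      _ = _ := by rw [lintegral_add_left hMe, lintegral_const_mul' _ _ (by simp)]
  rw [two_mul] at h2
  exact (ENNReal.add_le_add_iff_left (lintegral_dyadicSup_sq_ne_top F a)).1 h2

lemma nnnorm_avg_mul_volume_le (f : ℝ → ℝ) (p : ℤ × ℤ) :
    (‖avg f p‖₊ : ℝ≥0∞) * volume (dyadic p) ≤ ∫⁻ x in dyadic p, ‖f x‖ₑ := by
  refine le_trans (le_of_eq ?_) (enorm_integral_le_lintegral_enorm f)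
  rw [volume_dyadic, ← Real.enorm_of_nonneg (dlen_pos p).le]
  change ‖avg f p‖ₑ * _ = _
  rw [← enorm_mul, avg, mul_right_comm, inv_mul_cancel₀ (dlen_pos p).ne', one_mul]

lemma ofReal_sq_eq_enorm_sq (r : ℝ) : ENNReal.ofReal (r ^ 2) = ‖r‖ₑ ^ 2 := by
  rw [← sq_abs, ENNReal.ofReal_pow (abs_nonneg r), Real.enorm_eq_ofReal_abs]

/-- The `L²(ℝ)` mass of the `q`-th member of a family is spread over `dyadic q` in the second
variable. -/
lemma lintegral_sum_dyadicSup_sq_mul_le (F G : Finset (ℤ × ℤ)) {g : ℤ × ℤ → ℝ → ℝ}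
    (hg : ∀ q, MemLp (g q) 2 volume) :
    ∫⁻ z : ℝ × ℝ, ∑ q ∈ G, (dyadicSup F (fun p => ‖avg (g q) p‖₊) z.1 : ℝ≥0∞) ^ 2 *
        (dyadic q).indicator (fun _ => (ENNReal.ofReal (dlen q))⁻¹) z.2 ≤
      4 * ENNReal.ofReal (∑ q ∈ G, ∫ x, g q x ^ 2) := by
  have hM (q : ℤ × ℤ) : Measurable fun x =>
      (dyadicSup F (fun p => ‖avg (g q) p‖₊) x : ℝ≥0∞) ^ 2 :=
    (measurable_dyadicSup F _).coe_nnreal_ennreal.pow_const 2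
  have hw (q : ℤ × ℤ) :
      Measurable ((dyadic q).indicator (fun _ => (ENNReal.ofReal (dlen q))⁻¹)) :=
    measurable_const.indicator (measurableSet_dyadic q)
  have hMw (q : ℤ × ℤ) : Measurable fun z : ℝ × ℝ =>
      (dyadicSup F (fun p => ‖avg (g q) p‖₊) z.1 : ℝ≥0∞) ^ 2 *
        (dyadic q).indicator (fun _ => (ENNReal.ofReal (dlen q))⁻¹) z.2 :=
    ((hM q).comp measurable_fst).mul ((hw q).comp measurable_snd)
  rw [lintegral_finsetSum _ fun q _ => hMw q, ENNReal.ofReal_sum_of_nonneg fun q _ => by positivity,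
    Finset.mul_sum]
  refine Finset.sum_le_sum fun q _ => ?_
  rw [Measure.volume_eq_prod, lintegral_prod_mul (hM q).aemeasurable (hw q).aemeasurable,
    lintegral_indicator_const (measurableSet_dyadic q), volume_dyadic,
    ENNReal.inv_mul_cancel (by simpa using dlen_pos q) (by simp), mul_one]
  refine (lintegral_dyadicSup_sq_le (hg q).1.enorm F _ (nnnorm_avg_mul_volume_le (g q))).trans ?_
  rw [ofReal_integral_eq_lintegral_ofReal (hg q).integrable_sq
    (ae_of_all _ fun x => sq_nonneg _)]
  simp only [ofReal_sq_eq_enorm_sq, le_refl]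

lemma avg_zero (p : ℤ × ℤ) : avg 0 p = 0 := by simp [avg]

lemma ofReal_sqfn_sq_le {u g : ℤ × ℤ → ℝ → ℝ} {P Q : Finset (ℤ × ℤ)}
    (hP : ∀ p ∉ P, u p = 0) (hQ : ∀ q ∉ Q, g q = 0) (z : ℝ × ℝ) :
    ENNReal.ofReal (sqfn (fun p q => avg (g q) p * avg (u p) q) z) ^ 2 ≤
      (∑ q ∈ Q, (dyadicSup P (fun p => ‖avg (g q) p‖₊) z.1 : ℝ≥0∞) ^ 2 *
        (dyadic q).indicator (fun _ => (ENNReal.ofReal (dlen q))⁻¹) z.2) *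
      ∑ p ∈ P, (dyadicSup Q (fun q => ‖avg (u p) q‖₊) z.2 : ℝ≥0∞) ^ 2 *
        (dyadic p).indicator (fun _ => (ENNReal.ofReal (dlen p))⁻¹) z.1 := by
  have hnn (pq : (ℤ × ℤ) × (ℤ × ℤ)) : 0 ≤ (avg (g pq.2) pq.1 * avg (u pq.1) pq.2) ^ 2 *
      Set.indicator (dyadic pq.1 ×ˢ dyadic pq.2) 1 z / (dlen pq.1 * dlen pq.2) := by
    have := dlen_pos pq.1
    have := dlen_pos pq.2
    have : 0 ≤ Set.indicator (dyadic pq.1 ×ˢ dyadic pq.2) (1 : ℝ × ℝ → ℝ) z :=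
      Set.indicator_nonneg (fun _ _ => zero_le_one) z
    positivity
  have hsum := tsum_eq_sum (L := .unconditional _) (s := P ×ˢ Q) (f := fun pq : (ℤ × ℤ) × (ℤ × ℤ) =>
      (avg (g pq.2) pq.1 * avg (u pq.1) pq.2) ^ 2 *
      Set.indicator (dyadic pq.1 ×ˢ dyadic pq.2) 1 z / (dlen pq.1 * dlen pq.2)) (by
    intro pq hpq
    rw [Finset.mem_product, not_and_or] at hpq
    rcases hpq with h | h
    · simp [hP _ h, avg_zero]
    · simp [hQ _ h, avg_zero])
  rw [sqfn, ← ENNReal.ofReal_pow (Real.sqrt_nonneg _), Real.sq_sqrt (tsum_nonneg hnn), hsum,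
    ENNReal.ofReal_sum_of_nonneg fun pq _ => hnn pq, Finset.sum_mul_sum, Finset.sum_comm,
    ← Finset.sum_product']
  refine Finset.sum_le_sum fun pq hpq => ?_
  obtain ⟨p, q⟩ := pq
  obtain ⟨hp, hq⟩ := Finset.mem_product.1 hpq
  obtain ⟨x, y⟩ := z
  by_cases hx : x ∈ dyadic p
  · by_cases hy : y ∈ dyadic q
    · have h1 := le_dyadicSup (fun p => ‖avg (g q) p‖₊) hp hx
      have h2 := le_dyadicSup (fun q => ‖avg (u p) q‖₊) hq hy
      simp only [Set.mem_prod, hx, hy, and_self, Set.indicator_of_mem, Pi.one_apply, mul_one]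
      have hpp := dlen_pos p
      have hqq := dlen_pos q
      rw [div_eq_mul_inv, ENNReal.ofReal_mul (sq_nonneg _), mul_inv,
        ENNReal.ofReal_mul (by positivity), ENNReal.ofReal_inv_of_pos hpp,
        ENNReal.ofReal_inv_of_pos hqq, mul_pow, ENNReal.ofReal_mul (sq_nonneg _)]
      rw [ofReal_sq_eq_enorm_sq, ofReal_sq_eq_enorm_sq, mul_comm (_⁻¹) (_⁻¹), mul_mul_mul_comm]
      gcongr
      · exact ENNReal.coe_le_coe.2 h1
      · exact ENNReal.coe_le_coe.2 h2
    · simp [hy]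
  · simp [hx]

/-- there is an absolute constant `C > 0` such that for all admissible families
`(g_J)`, `(u_I)`, the square function of `A_{IJ} = ⟨g_J⟩_I ⟨u_I⟩_J` satisfies
`‖s_A‖_{L¹(ℝ²)} ≤ C (Σ_J ‖g_J‖₂²)^{1/2} (Σ_I ‖u_I‖₂²)^{1/2}`. -/
theorem sqfn_L1_bound :
    ∃ C : ℝ, 0 < C ∧ ∀ u g : (ℤ × ℤ) → ℝ → ℝ,
      (∀ p, MemLp (u p) 2 volume) → (∀ q, MemLp (g q) 2 volume) →
      {p | u p ≠ 0}.Finite → {q | g q ≠ 0}.Finite →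
      (∫⁻ z : ℝ × ℝ, ENNReal.ofReal (sqfn (fun p q => avg (g q) p * avg (u p) q) z)) ≤
        ENNReal.ofReal (C * Real.sqrt (∑' q : ℤ × ℤ, ∫ x, (g q x) ^ 2) *
          Real.sqrt (∑' p : ℤ × ℤ, ∫ x, (u p x) ^ 2)) := by
  refine ⟨4, by norm_num, fun u g hu hg hP hQ => ?_⟩
  set P := hP.toFinset
  set Q := hQ.toFinset
  have hP0 (p : ℤ × ℤ) (hp : p ∉ P) : u p = 0 := by simpa [P] using hp
  have hQ0 (q : ℤ × ℤ) (hq : q ∉ Q) : g q = 0 := by simpa [Q] using hq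
  rw [tsum_eq_sum (s := Q) fun q hq => by simp [hQ0 q hq],
    tsum_eq_sum (s := P) fun p hp => by simp [hP0 p hp]]
  set A : ℝ × ℝ → ℝ≥0∞ := fun z =>
    ∑ q ∈ Q, (dyadicSup P (fun p => ‖avg (g q) p‖₊) z.1 : ℝ≥0∞) ^ 2 *
      (dyadic q).indicator (fun _ => (ENNReal.ofReal (dlen q))⁻¹) z.2
  set B : ℝ × ℝ → ℝ≥0∞ := fun z =>
    ∑ p ∈ P, (dyadicSup Q (fun q => ‖avg (u p) q‖₊) z.1 : ℝ≥0∞) ^ 2 *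
      (dyadic p).indicator (fun _ => (ENNReal.ofReal (dlen p))⁻¹) z.2
  have hmeas (F G : Finset (ℤ × ℤ)) (v : ℤ × ℤ → ℝ → ℝ) : Measurable fun z : ℝ × ℝ =>
      ∑ q ∈ G, (dyadicSup F (fun p => ‖avg (v q) p‖₊) z.1 : ℝ≥0∞) ^ 2 *
        (dyadic q).indicator (fun _ => (ENNReal.ofReal (dlen q))⁻¹) z.2 :=
    Finset.measurable_sum _ fun q _ =>
      (((measurable_dyadicSup F _).coe_nnreal_ennreal.pow_const 2).comp measurable_fst).mul
        ((measurable_const.indicator (measurableSet_dyadic q)).comp measurable_snd)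
  have hAm : Measurable A := hmeas P Q g
  have hBm : Measurable B := hmeas Q P u
  have hBswap : ∫⁻ z : ℝ × ℝ, B z.swap = ∫⁻ z, B z :=
    lintegral_prod_swap (μ := volume) (ν := volume) B
  have hpt (z : ℝ × ℝ) : ENNReal.ofReal (sqfn (fun p q => avg (g q) p * avg (u p) q) z) ≤
      A z ^ (1 / 2 : ℝ) * B z.swap ^ (1 / 2 : ℝ) := by
    have := ENNReal.rpow_le_rpow (ofReal_sqfn_sq_le hP0 hQ0 z) (z := 1 / 2) (by norm_num)
    rwa [← ENNReal.rpow_natCast, ← ENNReal.rpow_mul, ENNReal.mul_rpow_of_nonneg _ _ (by norm_num),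
      show ((2 : ℕ) : ℝ) * (1 / 2) = 1 by norm_num, ENNReal.rpow_one] at this
  have hhalf (a : ℝ≥0∞) : (a ^ (1 / 2 : ℝ)) ^ (2 : ℝ) = a := by
    rw [← ENNReal.rpow_mul]; norm_num
  have hconv {s : ℝ} (hs : 0 ≤ s) :
      (4 * ENNReal.ofReal s) ^ (1 / 2 : ℝ) = ENNReal.ofReal (2 * √s) := by
    rw [show (4 : ℝ≥0∞) = ENNReal.ofReal 4 by simp, ← ENNReal.ofReal_mul (by norm_num),
      ENNReal.ofReal_rpow_of_nonneg (by positivity) (by norm_num), ← Real.sqrt_eq_rpow,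
      Real.sqrt_mul (by norm_num), show (4 : ℝ) = 2 ^ 2 by norm_num, Real.sqrt_sq (by norm_num)]
  have hnn (G : Finset (ℤ × ℤ)) (v : ℤ × ℤ → ℝ → ℝ) : 0 ≤ ∑ q ∈ G, ∫ x, v q x ^ 2 :=
    Finset.sum_nonneg fun q _ => integral_nonneg fun x => sq_nonneg _
  calc ∫⁻ z : ℝ × ℝ, ENNReal.ofReal (sqfn (fun p q => avg (g q) p * avg (u p) q) z)
      ≤ ∫⁻ z : ℝ × ℝ, A z ^ (1 / 2 : ℝ) * B z.swap ^ (1 / 2 : ℝ) := lintegral_mono hpt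
    _ ≤ (∫⁻ z, (A z ^ (1 / 2 : ℝ)) ^ (2 : ℝ)) ^ (1 / 2 : ℝ) *
          (∫⁻ z : ℝ × ℝ, (B z.swap ^ (1 / 2 : ℝ)) ^ (2 : ℝ)) ^ (1 / 2 : ℝ) :=
        ENNReal.lintegral_mul_le_Lp_mul_Lq volume Real.HolderConjugate.two_two
          (hAm.pow_const _).aemeasurable ((hBm.comp measurable_swap).pow_const _).aemeasurable
    _ = (∫⁻ z, A z) ^ (1 / 2 : ℝ) * (∫⁻ z, B z) ^ (1 / 2 : ℝ) := by
        simp only [hhalf, hBswap]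
    _ ≤ (4 * ENNReal.ofReal (∑ q ∈ Q, ∫ x, g q x ^ 2)) ^ (1 / 2 : ℝ) *
          (4 * ENNReal.ofReal (∑ p ∈ P, ∫ x, u p x ^ 2)) ^ (1 / 2 : ℝ) := by
        gcongr
        · exact lintegral_sum_dyadicSup_sq_mul_le P Q hg
        · exact lintegral_sum_dyadicSup_sq_mul_le Q P hu
    _ = _ := by
        rw [hconv (hnn Q g), hconv (hnn P u), ← ENNReal.ofReal_mul (by positivity)]
        congr 1
        ring

end
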